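/- For every p ≥ 1 there exists a constant C_p > 0 such that for every ℓ ∈ ℕ, if b = (b_0, …, b_ℓ) is a vector of independent standard Gaussian real random variables and B^ℓ = T_ℓ(b) is the (ℓ+1)×(ℓ+1) lower triangular Toeplitz matrix with first column b, then E[ ‖B^ℓ‖_op^p ] ≤ C_p · max( (ℓ · log ℓ)^{p/2}, 1 ). -/

import Mathlib

open MeasureTheory ProbabilityTheory

/-- The spectral (operator) norm of a real matrix. -/
noncomputable def matOpNorm {n m : ℕ} (A : Matrix (Fin n) (Fin m) ℝ) : ℝ :=
  ‖LinearMap.toContinuousLinearMap (Matrix.toEuclideanLin A)‖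

/-- The `(ℓ+1)×(ℓ+1)` lower triangular Toeplitz matrix with first column `b`. -/
def toepOfVec {ℓ : ℕ} (b : Fin (ℓ + 1) → ℝ) : Matrix (Fin (ℓ + 1)) (Fin (ℓ + 1)) ℝ :=
  Matrix.of fun i j =>
    if (j : ℕ) ≤ (i : ℕ) then
      b ⟨(i : ℕ) - (j : ℕ), lt_of_le_of_lt (Nat.sub_le _ _) i.isLt⟩
    else 0

/-- Discrete Parseval identity for polynomials of small degree. -/
theorem gt_parseval (N : ℕ) (hN : 0 < N) (ω : ℂ) (hω : IsPrimitiveRoot ω N)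
    (P : Polynomial ℂ) (hP : P.natDegree < N) :
    ∑ k ∈ Finset.range N, ‖P.eval (ω ^ k)‖ ^ 2 =
      N * ∑ m ∈ Finset.range N, ‖P.coeff m‖ ^ 2 := by
  have hnorm : ‖ω‖ = 1 := hω.norm'_eq_one hN.ne'
  have hcc : ω * (starRingEnd ℂ) ω = 1 := by
    rw [Complex.mul_conj, Complex.normSq_eq_norm_sq, hnorm]; simp
  have horth : ∀ m ∈ Finset.range N, ∀ l ∈ Finset.range N,
      ∑ k ∈ Finset.range N, (ω ^ m * (starRingEnd ℂ) ω ^ l) ^ k = if m = l then (N : ℂ) else 0 := by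
    intro m hm l hl
    rw [Finset.mem_range] at hm hl
    by_cases h : m = l
    · subst h
      simp [← mul_pow, hcc]
    · rw [if_neg h]
      have hz : ω ^ m * (starRingEnd ℂ) ω ^ l ≠ 1 := by
        intro hz
        apply h
        apply hω.pow_inj hm hl
        calc ω ^ m = ω ^ m * (ω * (starRingEnd ℂ) ω) ^ l := by rw [hcc]; simp
          _ = (ω ^ m * (starRingEnd ℂ) ω ^ l) * ω ^ l := by rw [mul_pow]; ring
          _ = ω ^ l := by rw [hz, one_mul]
      rw [geom_sum_eq hz]
      have : (ω ^ m * (starRingEnd ℂ) ω ^ l) ^ N = 1 := by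
        rw [mul_pow, ← pow_mul, ← pow_mul, mul_comm m, mul_comm l, pow_mul, pow_mul, ← map_pow,
          hω.pow_eq_one]
        simp
      rw [this]; simp
  have hsq : ∀ z : ℂ, ((‖z‖ ^ 2 : ℝ) : ℂ) = z * (starRingEnd ℂ) z := by
    intro z; rw [Complex.mul_conj, Complex.normSq_eq_norm_sq]
  apply Complex.ofReal_injective
  rw [Complex.ofReal_sum, Complex.ofReal_mul, Complex.ofReal_sum]
  simp only [hsq, Complex.ofReal_natCast]
  simp only [Polynomial.eval_eq_sum_range' hP, map_sum, map_mul, map_pow]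
  simp only [Finset.sum_mul_sum]
  rw [Finset.sum_comm, Finset.mul_sum]
  refine Finset.sum_congr rfl fun m hm => ?_
  rw [Finset.sum_comm]
  have : ∀ l ∈ Finset.range N, ∑ k ∈ Finset.range N, P.coeff m * (ω ^ k) ^ m *
      ((starRingEnd ℂ) (P.coeff l) * ((starRingEnd ℂ) ω ^ k) ^ l) =
      if m = l then P.coeff m * (starRingEnd ℂ) (P.coeff l) * N else 0 := by
    intro l hl
    have := horth m hm l hl
    calc _ = P.coeff m * (starRingEnd ℂ) (P.coeff l) *
        ∑ k ∈ Finset.range N, (ω ^ m * (starRingEnd ℂ) ω ^ l) ^ k := by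
          rw [Finset.mul_sum]
          refine Finset.sum_congr rfl fun k _ => ?_
          rw [mul_pow, ← pow_mul, ← pow_mul, ← pow_mul, ← pow_mul, mul_comm k m, mul_comm k l]
          ring
      _ = _ := by rw [this]; split_ifs <;> simp
  rw [Finset.sum_congr rfl this, Finset.sum_ite_eq, if_pos hm]
  ring

/-- The polynomial with given coefficient vector. -/
noncomputable def gtPoly {n : ℕ} (b : Fin n → ℝ) : Polynomial ℂ :=
  ∑ j : Fin n, Polynomial.C (b j : ℂ) * Polynomial.X ^ (j : ℕ)

theorem gtPoly_coeff {n : ℕ} (b : Fin n → ℝ) (m : ℕ) :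
    (gtPoly b).coeff m = if h : m < n then (b ⟨m, h⟩ : ℂ) else 0 := by
  simp only [gtPoly, Polynomial.finsetSum_coeff, Polynomial.coeff_C_mul_X_pow]
  split_ifs with h
  · rw [Finset.sum_eq_single ⟨m, h⟩]
    · simp
    · intro j _ hj
      rw [if_neg]
      intro h'; apply hj; ext; simp [h']
    · simp
  · apply Finset.sum_eq_zero
    intro j _
    rw [if_neg]
    have := j.2
    omega

theorem gtPoly_natDegree {n : ℕ} (b : Fin (n + 1) → ℝ) : (gtPoly b).natDegree ≤ n := by
  rw [Polynomial.natDegree_le_iff_coeff_eq_zero]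
  intro m hm
  rw [gtPoly_coeff, dif_neg (by omega)]

theorem gt_conv {ℓ : ℕ} (b x : Fin (ℓ + 1) → ℝ) (i : Fin (ℓ + 1)) :
    (gtPoly b * gtPoly x).coeff i = ((toepOfVec b).mulVec x i : ℝ) := by
  rw [mul_comm, Polynomial.coeff_mul, Finset.Nat.sum_antidiagonal_eq_sum_range_succ_mk]
  simp only [Matrix.mulVec, dotProduct, toepOfVec, Matrix.of_apply, gtPoly_coeff]
  push_cast
  rw [← Finset.sum_subset (s₁ := Finset.univ.filter fun j : Fin (ℓ+1) => (j : ℕ) ≤ i) (Finset.subset_univ _)]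
  · symm
    refine Finset.sum_bij (fun j _ => (j : ℕ)) ?_ ?_ ?_ ?_
    · intro j hj; simp at hj ⊢; omega
    · intro j _ j' _ h; exact Fin.ext h
    · intro m hm
      rw [Finset.mem_range] at hm
      have := i.2
      exact ⟨⟨m, by omega⟩, Finset.mem_filter.2 ⟨Finset.mem_univ _, Nat.lt_succ_iff.1 hm⟩, rfl⟩
    · intro j hj
      simp only [Finset.mem_filter, Finset.mem_univ, true_and] at hj
      have := i.2
      rw [if_pos hj, dif_pos j.2, dif_pos (by omega)]
      simp [mul_comm]
  · intro j _ hj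
    simp only [Finset.mem_filter, Finset.mem_univ, true_and] at hj
    rw [if_neg hj]; simp

theorem gt_sumsq {n N : ℕ} (h : n ≤ N) (x : Fin n → ℝ) :
    ∑ m ∈ Finset.range N, ‖(gtPoly x).coeff m‖ ^ 2 = ∑ j, x j ^ 2 := by
  rw [← Finset.sum_subset (s₁ := Finset.range n) (by simpa using h)]
  · rw [Finset.sum_range]
    refine Finset.sum_congr rfl fun j _ => ?_
    rw [gtPoly_coeff, dif_pos j.2]; simp
  · intro m _ hm
    rw [gtPoly_coeff, dif_neg (by simpa using hm)]; simp

theorem gt_opNorm_le {ℓ : ℕ} (b : Fin (ℓ + 1) → ℝ) (ω : ℂ)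
    (hω : IsPrimitiveRoot ω (2 * (ℓ + 1))) (D : ℝ) (hD : 0 ≤ D)
    (h : ∀ k ∈ Finset.range (2 * (ℓ + 1)), ‖(gtPoly b).eval (ω ^ k)‖ ≤ D) :
    matOpNorm (toepOfVec b) ≤ D := by
  unfold matOpNorm
  refine ContinuousLinearMap.opNorm_le_bound _ hD fun x => ?_
  set N := 2 * (ℓ + 1) with hNdef
  have hN : 0 < N := by omega
  refine le_of_sq_le_sq ?_ (by positivity)
  rw [mul_pow, EuclideanSpace.norm_sq_eq, EuclideanSpace.norm_sq_eq]
  have hd := gtPoly_natDegree b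
  have hd' := gtPoly_natDegree (fun i => x i)
  have p1 := gt_parseval N hN ω hω (gtPoly b * gtPoly (fun i => x i))
    (lt_of_le_of_lt Polynomial.natDegree_mul_le (by omega))
  have p2 := gt_parseval N hN ω hω (gtPoly (fun i => x i)) (by omega)
  rw [gt_sumsq (by omega)] at p2
  have h1 : ∑ k ∈ Finset.range N, ‖(gtPoly b * gtPoly (fun i => x i)).eval (ω ^ k)‖ ^ 2 ≤
      D ^ 2 * ∑ k ∈ Finset.range N, ‖(gtPoly (fun i => x i)).eval (ω ^ k)‖ ^ 2 := by
    rw [Finset.mul_sum]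
    refine Finset.sum_le_sum fun k hk => ?_
    rw [Polynomial.eval_mul, norm_mul, mul_pow]
    gcongr
    exact h k hk
  rw [p1, p2] at h1
  have h2 : ∑ i : Fin (ℓ + 1), ‖(LinearMap.toContinuousLinearMap
      (Matrix.toEuclideanLin (toepOfVec b))) x i‖ ^ 2 ≤
      ∑ m ∈ Finset.range N, ‖(gtPoly b * gtPoly (fun i => x i)).coeff m‖ ^ 2 := by
    calc _ = ∑ m ∈ Finset.range (ℓ + 1), ‖(gtPoly b * gtPoly (fun i => x i)).coeff m‖ ^ 2 := by
          rw [Finset.sum_range]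
          refine Finset.sum_congr rfl fun i _ => ?_
          rw [gt_conv, Complex.norm_real]
          rfl
      _ ≤ _ := by
          apply Finset.sum_le_sum_of_subset_of_nonneg
          · intro m; simp; omega
          · intros; positivity
  refine h2.trans ?_
  have hN' : (0 : ℝ) < N := by exact_mod_cast hN
  refine le_of_mul_le_mul_left (h1.trans (le_of_eq ?_)) hN'
  simp only [Real.norm_eq_abs, sq_abs]
  ring

theorem gt_mgf {n : ℕ} (c : Fin n → ℝ) (hc : ∀ j, |c j| ≤ 1) (s : ℝ) :
    Integrable (fun b : Fin n → ℝ => Real.exp (s * ∑ j, c j * b j))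
      (Measure.pi fun _ : Fin n => gaussianReal 0 1) ∧
    ∫ b : Fin n → ℝ, Real.exp (s * ∑ j, c j * b j)
      ∂(Measure.pi fun _ : Fin n => gaussianReal 0 1) ≤ Real.exp (s ^ 2 * n / 2) := by
  have e : (fun b : Fin n → ℝ => Real.exp (s * ∑ j, c j * b j)) =
      fun b => ∏ j, Real.exp ((s * c j) * b j) := by
    funext b
    rw [← Real.exp_sum, Finset.mul_sum]
    congr 1
    exact Finset.sum_congr rfl fun j _ => by ring
  rw [e]
  constructor
  · exact Integrable.fintype_prod (f := fun j (y : ℝ) => Real.exp ((s * c j) * y))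
      (fun j => integrable_exp_mul_gaussianReal _)
  · rw [integral_fintype_prod_eq_prod (fun j (y : ℝ) => Real.exp ((s * c j) * y))]
    have : ∀ j, ∫ y, Real.exp ((s * c j) * y) ∂(gaussianReal 0 1) ≤ Real.exp (s ^ 2 / 2) := by
      intro j
      have h := congrFun (mgf_id_gaussianReal (μ := 0) (v := 1)) (s * c j)
      simp only [mgf, id] at h
      rw [h]
      apply Real.exp_le_exp.mpr
      have h1 : c j ^ 2 ≤ 1 := (sq_le_one_iff_abs_le_one _).2 (hc j)
      have h2 := mul_le_mul_of_nonneg_left h1 (sq_nonneg s)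
      simp
      nlinarith
    calc _ ≤ ∏ j : Fin n, Real.exp (s ^ 2 / 2) :=
          Finset.prod_le_prod (fun j _ => integral_nonneg fun y => (Real.exp_pos _).le)
            (fun j _ => this j)
      _ = _ := by
          rw [Finset.prod_const, ← Real.exp_nat_mul]
          simp; ring

theorem gt_pointwise (p : ℝ) (hp : 1 ≤ p) (t K : ℝ) (ht : 0 ≤ t) (hK : 1 ≤ K) :
    t ^ p ≤ K ^ p * p ^ p * (1 + Real.exp (t - K)) := by
  have hpp : 1 ≤ p ^ p := Real.one_le_rpow hp (by linarith)
  have hK0 : 0 ≤ K ^ p := by positivity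
  rcases le_total t K with h | h
  · have h1 : t ^ p ≤ K ^ p := Real.rpow_le_rpow ht h (by linarith)
    have := Real.exp_pos (t - K)
    calc t ^ p ≤ K ^ p * 1 * 1 := by simpa using h1
      _ ≤ _ := by gcongr; linarith
  · set s := t - K with hs
    have hs0 : 0 ≤ s := by linarith
    have h1 : t ≤ K * (p * Real.exp (s / p)) := by
      have := Real.add_one_le_exp (s / p)
      have h2 : p * (s / p + 1) ≤ p * Real.exp (s / p) := by gcongr
      have h3 : p * (s / p + 1) = s + p := by field_simp
      have : K * (s + 1) ≤ K * (p * Real.exp (s / p)) := by gcongr; linarith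
      nlinarith
    calc t ^ p ≤ (K * (p * Real.exp (s / p))) ^ p := Real.rpow_le_rpow ht h1 (by linarith)
      _ = K ^ p * p ^ p * Real.exp s := by
        rw [Real.mul_rpow (by positivity) (by positivity),
          Real.mul_rpow (by positivity) (by positivity), ← Real.exp_mul, mul_assoc]
        congr 4; field_simp
      _ ≤ _ := by gcongr; linarith

theorem gt_exp_le {ℓ : ℕ} (ω : ℂ) (hω : IsPrimitiveRoot ω (2 * (ℓ + 1)))
    (b : Fin (ℓ + 1) → ℝ) (s : ℝ) (hs : 0 ≤ s) :
    Real.exp (s * matOpNorm (toepOfVec b)) ≤ ∑ k ∈ Finset.range (2 * (ℓ + 1)),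
      (Real.exp ((2 * s) * ∑ j : Fin (ℓ + 1), ((ω ^ k) ^ (j : ℕ)).re * b j) +
       Real.exp ((-(2 * s)) * ∑ j : Fin (ℓ + 1), ((ω ^ k) ^ (j : ℕ)).re * b j) +
       Real.exp ((2 * s) * ∑ j : Fin (ℓ + 1), ((ω ^ k) ^ (j : ℕ)).im * b j) +
       Real.exp ((-(2 * s)) * ∑ j : Fin (ℓ + 1), ((ω ^ k) ^ (j : ℕ)).im * b j)) := by
  obtain ⟨k, hk, hmax⟩ := Finset.exists_max_image (Finset.range (2 * (ℓ + 1)))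
    (fun k => ‖(gtPoly b).eval (ω ^ k)‖) ⟨0, by simp⟩
  have h := gt_opNorm_le b ω hω _ (norm_nonneg _) hmax
  refine le_trans ?_ (Finset.single_le_sum (fun i _ => by positivity) hk)
  set z := (gtPoly b).eval (ω ^ k) with hz
  have hzz : z = ∑ j : Fin (ℓ + 1), (b j : ℂ) * (ω ^ k) ^ (j : ℕ) := by
    rw [hz, gtPoly, Polynomial.eval_finsetSum]
    simp
  have hre : ∑ j : Fin (ℓ + 1), ((ω ^ k) ^ (j : ℕ)).re * b j = z.re := by
    rw [hzz, Complex.re_sum]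
    exact Finset.sum_congr rfl fun j _ => by rw [Complex.re_ofReal_mul, mul_comm]
  have him : ∑ j : Fin (ℓ + 1), ((ω ^ k) ^ (j : ℕ)).im * b j = z.im := by
    rw [hzz, Complex.im_sum]
    exact Finset.sum_congr rfl fun j _ => by rw [Complex.im_ofReal_mul, mul_comm]
  rw [hre, him]
  have h3 := Complex.norm_le_abs_re_add_abs_im z
  have h4 : s * matOpNorm (toepOfVec b) ≤ s * (|z.re| + |z.im|) := by gcongr; linarith
  have e1 := Real.exp_pos (2 * s * z.re)
  have e2 := Real.exp_pos (-(2 * s) * z.re)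
  have e3 := Real.exp_pos (2 * s * z.im)
  have e4 := Real.exp_pos (-(2 * s) * z.im)
  have key : ∀ u : ℝ, s * matOpNorm (toepOfVec b) ≤ u →
      Real.exp (s * matOpNorm (toepOfVec b)) ≤ Real.exp u := fun u hu => Real.exp_le_exp.2 hu
  rcases le_total |z.re| |z.im| with hh | hh
  · have h5 : s * (|z.re| + |z.im|) ≤ 2 * s * |z.im| := by nlinarith
    rcases abs_cases z.im with ⟨ha, _⟩ | ⟨ha, _⟩
    · have := key (2 * s * z.im) (by rw [ha] at h5; rw [ha] at h4; linarith)
      linarith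
    · have := key (-(2 * s) * z.im) (by rw [ha] at h5; rw [ha] at h4; linarith)
      linarith
  · have h5 : s * (|z.re| + |z.im|) ≤ 2 * s * |z.re| := by nlinarith
    rcases abs_cases z.re with ⟨ha, _⟩ | ⟨ha, _⟩
    · have := key (2 * s * z.re) (by rw [ha] at h5; rw [ha] at h4; linarith)
      linarith
    · have := key (-(2 * s) * z.re) (by rw [ha] at h5; rw [ha] at h4; linarith)
      linarith

theorem gt_exp_bound (ℓ : ℕ) (s : ℝ) (hs : 0 ≤ s) :
    ∃ G : (Fin (ℓ + 1) → ℝ) → ℝ,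
      Integrable G (Measure.pi fun _ : Fin (ℓ + 1) => gaussianReal 0 1) ∧
      (∀ b, Real.exp (s * matOpNorm (toepOfVec b)) ≤ G b) ∧
      ∫ b, G b ∂(Measure.pi fun _ : Fin (ℓ + 1) => gaussianReal 0 1) ≤
        8 * ((ℓ : ℝ) + 1) * Real.exp (2 * s ^ 2 * (ℓ + 1)) := by
  obtain ⟨ω, hω⟩ : ∃ ω : ℂ, IsPrimitiveRoot ω (2 * (ℓ + 1)) :=
    ⟨_, Complex.isPrimitiveRoot_exp (2 * (ℓ + 1)) (by omega)⟩
  have hnorm : ‖ω‖ = 1 := hω.norm'_eq_one (by omega)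
  have hr : ∀ k : ℕ, ∀ j : Fin (ℓ + 1), |((ω ^ k) ^ (j : ℕ)).re| ≤ 1 := fun k j =>
    (Complex.abs_re_le_norm _).trans (by simp [hnorm])
  have hi : ∀ k : ℕ, ∀ j : Fin (ℓ + 1), |((ω ^ k) ^ (j : ℕ)).im| ≤ 1 := fun k j =>
    (Complex.abs_im_le_norm _).trans (by simp [hnorm])
  have I1 := fun k => gt_mgf _ (hr k) (2 * s)
  have I2 := fun k => gt_mgf _ (hr k) (-(2 * s))
  have I3 := fun k => gt_mgf _ (hi k) (2 * s)
  have I4 := fun k => gt_mgf _ (hi k) (-(2 * s))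
  refine ⟨_, ?_, fun b => gt_exp_le ω hω b s hs, ?_⟩
  · exact integrable_finsetSum _ fun k _ =>
      (((I1 k).1.add (I2 k).1).add (I3 k).1).add (I4 k).1
  · rw [integral_finsetSum]
    swap
    · intro k _
      exact (((I1 k).1.add (I2 k).1).add (I3 k).1).add (I4 k).1
    have hk : ∀ k ∈ Finset.range (2 * (ℓ + 1)), ∫ b : Fin (ℓ + 1) → ℝ,
      (Real.exp ((2 * s) * ∑ j : Fin (ℓ + 1), ((ω ^ k) ^ (j : ℕ)).re * b j) +
       Real.exp ((-(2 * s)) * ∑ j : Fin (ℓ + 1), ((ω ^ k) ^ (j : ℕ)).re * b j) +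
       Real.exp ((2 * s) * ∑ j : Fin (ℓ + 1), ((ω ^ k) ^ (j : ℕ)).im * b j) +
       Real.exp ((-(2 * s)) * ∑ j : Fin (ℓ + 1), ((ω ^ k) ^ (j : ℕ)).im * b j))
       ∂(Measure.pi fun _ : Fin (ℓ + 1) => gaussianReal 0 1) ≤
        4 * Real.exp (2 * s ^ 2 * (ℓ + 1)) := by
      intro k _
      have E : Real.exp (2 * s ^ 2 * (ℓ + 1)) = Real.exp ((2 * s) ^ 2 * ((ℓ + 1 : ℕ) : ℝ) / 2) := by
        congr 1; push_cast; ring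
      have E' : Real.exp (2 * s ^ 2 * (ℓ + 1)) =
          Real.exp ((-(2 * s)) ^ 2 * ((ℓ + 1 : ℕ) : ℝ) / 2) := by
        congr 1; push_cast; ring
      rw [integral_add, integral_add, integral_add (I1 k).1 (I2 k).1]
      rotate_left
      · exact (I1 k).1.add (I2 k).1
      · exact (I3 k).1
      · exact ((I1 k).1.add (I2 k).1).add (I3 k).1
      · exact (I4 k).1
      have a1 := (I1 k).2
      have a2 := (I2 k).2
      have a3 := (I3 k).2
      have a4 := (I4 k).2
      rw [← E] at a1 a3
      rw [← E'] at a2 a4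
      linarith
    refine (Finset.sum_le_sum hk).trans (le_of_eq ?_)
    rw [Finset.sum_const, Finset.card_range, nsmul_eq_mul]
    push_cast; ring

theorem gt_size (ℓ : ℕ) : ((ℓ : ℝ) + 1) * Real.log (8 * (ℓ + 1)) ≤
    30 * max ((ℓ : ℝ) * Real.log ℓ) 1 := by
  rcases Nat.lt_or_ge ℓ 2 with h | h
  · have h1 : (ℓ : ℝ) ≤ 1 := by exact_mod_cast (by omega : ℓ ≤ 1)
    have h0 : (0 : ℝ) ≤ ℓ := by positivity
    have h2 : Real.log (8 * (ℓ + 1)) ≤ 15 := by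
      have := Real.log_le_sub_one_of_pos (x := 8 * ((ℓ : ℝ) + 1)) (by positivity)
      linarith
    calc _ ≤ ((ℓ : ℝ) + 1) * 15 := by gcongr
      _ ≤ 30 * 1 := by linarith
      _ ≤ _ := by gcongr; exact le_max_right _ _
  · have h2 : (2 : ℝ) ≤ ℓ := by exact_mod_cast h
    have hl : 0 ≤ Real.log ℓ := Real.log_nonneg (by linarith)
    have h3 : Real.log (8 * (ℓ + 1)) ≤ 5 * Real.log ℓ := by
      have : (5 : ℝ) * Real.log ℓ = Real.log ((ℓ : ℝ) ^ 5) := by rw [Real.log_pow]; norm_num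
      rw [this]
      apply Real.log_le_log (by positivity)
      have : (2 : ℝ) ^ 4 ≤ (ℓ : ℝ) ^ 4 := by gcongr
      nlinarith
    have h4 : 0 ≤ Real.log (8 * ((ℓ : ℝ) + 1)) := Real.log_nonneg (by linarith)
    calc _ ≤ (2 * (ℓ : ℝ)) * (5 * Real.log ℓ) := by gcongr; linarith
      _ = 10 * ((ℓ : ℝ) * Real.log ℓ) := by ring
      _ ≤ 30 * ((ℓ : ℝ) * Real.log ℓ) := by gcongr; norm_num
      _ ≤ _ := by gcongr; exact le_max_left _ _

/-- Moment bounds for the operator norm of a Gaussian lower triangular Toeplitz matrix: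
for every `p ≥ 1` there is `C_p > 0` such that for every `ℓ`, if the first column is a
standard Gaussian vector then `E[‖B^ℓ‖_op^p] ≤ C_p max((ℓ log ℓ)^{p/2}, 1)`. -/
theorem gaussian_toeplitz_opNorm_moments (p : ℝ) (hp : 1 ≤ p) :
    ∃ C : ℝ, 0 < C ∧ ∀ ℓ : ℕ,
      (∫ b, (matOpNorm (toepOfVec b)) ^ p
          ∂(Measure.pi fun _ : Fin (ℓ + 1) => gaussianReal 0 1))
        ≤ C * max (((ℓ : ℝ) * Real.log ℓ) ^ (p / 2)) 1 := by
  refine ⟨2 * (3 * p) ^ p * 30 ^ (p / 2), by positivity, fun ℓ => ?_⟩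
  set L := Real.log (8 * ((ℓ : ℝ) + 1)) with hL
  have hL1 : 1 ≤ L := by
    rw [hL, Real.le_log_iff_exp_le (by positivity)]
    have := Real.exp_one_lt_d9
    have : (0 : ℝ) ≤ ℓ := by positivity
    linarith
  set n : ℝ := (ℓ : ℝ) + 1 with hn
  have hn0 : 0 < n := by positivity
  set r := Real.sqrt (n * L) with hr
  have hr0 : 0 < r := Real.sqrt_pos.2 (by positivity)
  have hr2 : r ^ 2 = n * L := Real.sq_sqrt (by positivity)
  obtain ⟨G, hGi, hG, hGb⟩ := gt_exp_bound ℓ (r / n) (by positivity)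
  have hexp : 8 * ((ℓ : ℝ) + 1) * Real.exp (2 * (r / n) ^ 2 * (ℓ + 1)) = Real.exp (3 * L) := by
    have : 2 * (r / n) ^ 2 * ((ℓ : ℝ) + 1) = 2 * L := by
      rw [← hn, div_pow, hr2]; field_simp
    rw [this, show 3 * L = L + 2 * L by ring, Real.exp_add, hL, Real.exp_log (by positivity)]
  rw [hexp] at hGb
  have hM : ∀ b : Fin (ℓ + 1) → ℝ, 0 ≤ matOpNorm (toepOfVec b) := fun b => norm_nonneg _
  have hpt : ∀ b : Fin (ℓ + 1) → ℝ, matOpNorm (toepOfVec b) ^ p ≤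
      (r / L) ^ p * ((3 * L) ^ p * p ^ p) * (1 + Real.exp (-(3 * L)) * G b) := by
    intro b
    have h1 := gt_pointwise p hp (r / n * matOpNorm (toepOfVec b)) (3 * L)
      (mul_nonneg (by positivity) (hM b)) (by linarith)
    have h2 : matOpNorm (toepOfVec b) = (r / L) * (r / n * matOpNorm (toepOfVec b)) := by
      have : (r / L) * (r / n) = 1 := by
        rw [div_mul_div_comm, ← sq, hr2]; field_simp
      rw [← mul_assoc, this, one_mul]
    calc matOpNorm (toepOfVec b) ^ p
        = (r / L) ^ p * (r / n * matOpNorm (toepOfVec b)) ^ p := by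
          conv_lhs => rw [h2]
          rw [Real.mul_rpow (by positivity) (mul_nonneg (by positivity) (hM b))]
      _ ≤ (r / L) ^ p * ((3 * L) ^ p * p ^ p *
          (1 + Real.exp (r / n * matOpNorm (toepOfVec b) - 3 * L))) := by gcongr
      _ ≤ (r / L) ^ p * ((3 * L) ^ p * p ^ p * (1 + Real.exp (-(3 * L)) * G b)) := by
          gcongr
          rw [sub_eq_neg_add, Real.exp_add]
          gcongr
          exact hG b
      _ = _ := by ring
  have hA : (r / L) ^ p * ((3 * L) ^ p * p ^ p) = (3 * p) ^ p * (n * L) ^ (p / 2) := by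
    rw [← Real.mul_rpow (by positivity) (by positivity),
      ← Real.mul_rpow (by positivity) (by positivity)]
    have : r / L * (3 * L * p) = (3 * p) * r := by field_simp
    rw [this, Real.mul_rpow (by positivity) (by positivity), hr, Real.sqrt_eq_rpow,
      ← Real.rpow_mul (by positivity)]
    congr 2; ring
  have hint : ∫ b, (matOpNorm (toepOfVec b)) ^ p
          ∂(Measure.pi fun _ : Fin (ℓ + 1) => gaussianReal 0 1) ≤
      (3 * p) ^ p * (n * L) ^ (p / 2) * 2 := by
    calc _ ≤ ∫ b, (r / L) ^ p * ((3 * L) ^ p * p ^ p) * (1 + Real.exp (-(3 * L)) * G b)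
          ∂(Measure.pi fun _ : Fin (ℓ + 1) => gaussianReal 0 1) := by
          apply integral_mono_of_nonneg
          · exact Filter.Eventually.of_forall fun b => Real.rpow_nonneg (hM b) _
          · exact ((integrable_const _).add (hGi.const_mul _)).const_mul _
          · exact Filter.Eventually.of_forall hpt
      _ = (3 * p) ^ p * (n * L) ^ (p / 2) * (1 + Real.exp (-(3 * L)) *
          ∫ b, G b ∂(Measure.pi fun _ : Fin (ℓ + 1) => gaussianReal 0 1)) := by
          rw [integral_const_mul, hA, integral_add (integrable_const _) (hGi.const_mul _),
            integral_const_mul]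
          simp
      _ ≤ (3 * p) ^ p * (n * L) ^ (p / 2) * (1 + Real.exp (-(3 * L)) * Real.exp (3 * L)) := by
          gcongr
      _ = _ := by rw [← Real.exp_add]; norm_num
  refine hint.trans ?_
  have hs : n * L ≤ 30 * max ((ℓ : ℝ) * Real.log ℓ) 1 := gt_size ℓ
  have hmax : (max ((ℓ : ℝ) * Real.log ℓ) 1) ^ (p / 2) ≤
      max (((ℓ : ℝ) * Real.log ℓ) ^ (p / 2)) 1 := by
    rcases le_total ((ℓ : ℝ) * Real.log ℓ) 1 with h | h
    · rw [max_eq_right h]; simp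
    · rw [max_eq_left h]; exact le_max_left _ _
  have hfin : (n * L) ^ (p / 2) ≤ 30 ^ (p / 2) * max (((ℓ : ℝ) * Real.log ℓ) ^ (p / 2)) 1 := by
    calc _ ≤ (30 * max ((ℓ : ℝ) * Real.log ℓ) 1) ^ (p / 2) :=
          Real.rpow_le_rpow (by positivity) hs (by positivity)
      _ = 30 ^ (p / 2) * (max ((ℓ : ℝ) * Real.log ℓ) 1) ^ (p / 2) :=
          Real.mul_rpow (by norm_num) (by positivity)
      _ ≤ _ := by gcongr
  calc _ ≤ (3 * p) ^ p * (30 ^ (p / 2) * max (((ℓ : ℝ) * Real.log ℓ) ^ (p / 2)) 1) * 2 := by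
        gcongr
    _ = _ := by ring
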